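/- Suppose c is a coloring of Z_{2t} (t ≥ 1) with no rainbow 3-AP. Let A and B be the sets of colors used on the even and odd elements of Z_{2t}, respectively. Then |A \ B| ≤ 1 and |B \ A| ≤ 1. -/

import Mathlib

open Finset

/-- An exact `r`-coloring of a finite set `S`: every element of `S` gets a color in
`{1,...,r}` and every color in `{1,...,r}` is used on `S`. -/
def ExactColoring {G : Type*} [AddCommGroup G] (S : Finset G) (r : ℕ) (c : G → ℕ) : Prop :=
  (∀ x ∈ S, c x ∈ Finset.Icc 1 r) ∧ ∀ j ∈ Finset.Icc 1 r, ∃ x ∈ S, c x = j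

/-- `S` contains a rainbow `k`-term arithmetic progression under the coloring `c`:
`k` distinct elements `a, a+d, ..., a+(k-1)d` of `S` on which `c` is injective. -/
def RainbowAP {G : Type*} [AddCommGroup G] (S : Finset G) (k : ℕ) (c : G → ℕ) : Prop :=
  ∃ a d : G, (∀ i < k, a + i • d ∈ S) ∧
    Function.Injective (fun i : Fin k => a + (i : ℕ) • d) ∧
    Function.Injective (fun i : Fin k => c (a + (i : ℕ) • d))

/-- The anti-van der Waerden number: the smallest `r` such that every exact
`r`-coloring of `S` contains a rainbow `k`-AP. -/
noncomputable def aw {G : Type*} [AddCommGroup G] (S : Finset G) (k : ℕ) : ℕ :=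
  sInf {r : ℕ | ∀ c : G → ℕ, ExactColoring S r c → RainbowAP S k c}

/-- `aw` for the interval `[n] = {1,...,n}` of integers. -/
noncomputable def awI (n : ℤ) (k : ℕ) : ℕ := aw (Finset.Icc 1 n) k

/-- Without a rainbow 3-AP, two of the terms of `a, a + d, a + 2 • d` have the same color. -/
theorem eq_of_not_rainbowAP {G : Type*} [AddCommGroup G] [Fintype G] (c : G → ℕ)
    (hnr : ¬ RainbowAP (Finset.univ : Finset G) 3 c) (a d : G) :
    c a = c (a + d) ∨ c a = c (a + 2 • d) ∨ c (a + d) = c (a + 2 • d) := by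
  by_contra! h
  obtain ⟨h1, h2, h3⟩ := h
  have hinj : Function.Injective (fun i : Fin 3 => c (a + (i : ℕ) • d)) := by
    intro i j hij
    fin_cases i <;> fin_cases j <;> simp_all [eq_comm]
  exact hnr ⟨a, d, fun _ _ => Finset.mem_univ _,
    Function.Injective.of_comp (f := c) hinj, hinj⟩

/-- In a coloring of `ℕ` without rainbow 3-APs, all members of the parity class of `a` whose color
belongs to a family `P` of colors missing from the other class share one color. -/
theorem color_eq_of_no_rainbow (f : ℕ → ℕ)
    (hf : ∀ a d, f a = f (a + d) ∨ f a = f (a + 2 * d) ∨ f (a + d) = f (a + 2 * d))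
    (P : ℕ → Prop) (n : ℕ) :
    ∀ a, (∀ m, m % 2 ≠ a % 2 → ¬ P (f m)) → P (f a) → P (f (a + 2 * n)) →
      f a = f (a + 2 * n) := by
  induction n using Nat.strong_induction_on with
  | _ n ih =>
    intro a hP ha hb
    rcases Nat.even_or_odd' n with ⟨k, rfl | rfl⟩
    · rcases Nat.eq_zero_or_pos k with rfl | hk
      · simp
      have e : a + 2 * (2 * k) = a + 2 * k + 2 * k := by ring
      by_contra hne
      have hm : P (f (a + 2 * k)) := by
        rcases hf a (2 * k) with h | h | h
        · rwa [← h]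
        · exact absurd h hne
        · rwa [h]
      apply hne
      rw [ih k (by omega) a hP ha hm, e]
      exact ih k (by omega) _ (fun m h => hP m (by omega)) hm (e ▸ hb)
    · have hm : ¬ P (f (a + (2 * k + 1))) := hP _ (by omega)
      rcases hf a (2 * k + 1) with h | h | h
      · exact absurd (h ▸ ha) hm
      · exact h
      · exact absurd (h ▸ hb) hm

/-- In a coloring of `ZMod (2 * t)` without rainbow 3-APs, at most one color appears on the
elements of parity `p` but not on those of parity `q`. -/
theorem card_image_parity_sdiff_le_one (t : ℕ) [NeZero (2 * t)] (c : ZMod (2 * t) → ℕ)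
    (hnr : ¬ RainbowAP (Finset.univ : Finset (ZMod (2 * t))) 3 c) (p q : ℕ)
    (hpq : ∀ m, m % 2 ≠ p → m % 2 = q) :
    ((Finset.univ.filter (fun j : ZMod (2 * t) => (ZMod.val j) % 2 = p)).image c \
      (Finset.univ.filter (fun j : ZMod (2 * t) => (ZMod.val j) % 2 = q)).image c).card ≤ 1 := by
  have hf := eq_of_not_rainbowAP c hnr
  rw [Finset.card_le_one]
  intro x hx y hy
  simp only [Finset.mem_sdiff, Finset.mem_image, Finset.mem_filter, Finset.mem_univ,
    true_and] at hx hy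
  obtain ⟨⟨u, hu, rfl⟩, hu'⟩ := hx
  obtain ⟨⟨v, hv, rfl⟩, hv'⟩ := hy
  have key : ∀ u v : ZMod (2 * t), u.val % 2 = p → v.val % 2 = p → u.val ≤ v.val →
      (¬ ∃ a : ZMod (2 * t), a.val % 2 = q ∧ c a = c u) →
      (¬ ∃ a : ZMod (2 * t), a.val % 2 = q ∧ c a = c v) → c u = c v := by
    intro u v hu hv huv hu' hv'
    obtain ⟨n, hn⟩ : ∃ n, v.val = u.val + 2 * n := ⟨(v.val - u.val) / 2, by omega⟩
    have h := color_eq_of_no_rainbow (fun n : ℕ => c (n : ZMod (2 * t)))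
      (fun a d => by
        have := hf a d
        push_cast
        simpa [two_mul, two_nsmul] using this)
      (fun x => ¬ ∃ a : ZMod (2 * t), a.val % 2 = q ∧ c a = x) n u.val
      (fun m hm => not_not.mpr ⟨m, by
        rw [ZMod.val_natCast, Nat.mod_mul_right_mod]
        exact hpq m (hu ▸ hm), rfl⟩)
    simp only [← hn, ZMod.natCast_zmod_val] at h
    exact h hu' hv'
  rcases le_total u.val v.val with h | h
  · exact key u v hu hv h hu' hv'
  · exact (key v u hv hu h hv' hu').symm

theorem stmt18 (t : ℕ) (ht : 1 ≤ t) [NeZero (2 * t)]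
    (c : ZMod (2 * t) → ℕ)
    (hnr : ¬ RainbowAP (Finset.univ : Finset (ZMod (2 * t))) 3 c)
    (A B : Finset ℕ)
    (hA : A = (Finset.univ.filter (fun j : ZMod (2 * t) => (ZMod.val j) % 2 = 0)).image c)
    (hB : B = (Finset.univ.filter (fun j : ZMod (2 * t) => (ZMod.val j) % 2 = 1)).image c) :
    (A \ B).card ≤ 1 ∧ (B \ A).card ≤ 1 := by
  subst hA hB
  exact ⟨card_image_parity_sdiff_le_one t c hnr 0 1 (by omega),
    card_image_parity_sdiff_le_one t c hnr 1 0 (by omega)⟩
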